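/- arXiv:2105.15159 — 6 statements merged into one kernel-verified Lean document; each statement's English description precedes it below -/
import Mathlib

section
/- If P and D are arbitrary positive integers and (ρ_i)_{i=1}^P are arbitrary nonnegative reals with ρ_1 > 0, then (Σ_{i=1}^P ρ_i) / (min_{t=1,…,P} (Σ_{i=1}^{t−1} ρ_i + D·ρ_t)) ≥ 1 − (1 − 1/D)^P ≥ 1 − e^{−P/D}. -/
/-- If `m` is a lower bound for all the sums `∑ i ≤ t, ρ i + D * ρ (t + 1)` with `t < n`, then
`∑ i ≤ n, ρ i` is at least `m * (1 - (1 - 1 / D) ^ n)`. -/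
theorem mul_one_sub_pow_le_sum_Icc {D m : ℝ} (hD : 1 ≤ D) (ρ : ℕ → ℝ) (n : ℕ)
    (hm : ∀ t < n, m ≤ (∑ i ∈ Finset.Icc 1 t, ρ i) + D * ρ (t + 1)) :
    m * (1 - (1 - 1 / D) ^ n) ≤ ∑ i ∈ Finset.Icc 1 n, ρ i := by
  have hD0 : 0 < D := by linarith
  have hq : 0 ≤ 1 - 1 / D := by
    rw [sub_nonneg, div_le_one hD0]
    exact hD
  induction n with
  | zero => simp
  | succ n ih =>
    have ih' := mul_le_mul_of_nonneg_left (ih fun t ht => hm t (by lia)) hq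
    have hstep := mul_le_mul_of_nonneg_left (hm n n.lt_succ_self) (one_div_pos.mpr hD0).le
    rw [mul_add, ← mul_assoc, one_div_mul_cancel hD0.ne', one_mul] at hstep
    rw [Finset.sum_Icc_succ_top (by lia), pow_succ]
    linarith

/-- **Lemma 2.2 (Wolsey).**  For positive integers `P` and `D` and nonnegative reals
`ρ_1, …, ρ_P` with `ρ_1 > 0`, the ratio of `Σ_{i=1}^P ρ_i` to
`min_{t=1,…,P} (Σ_{i=1}^{t−1} ρ_i + D·ρ_t)` is at least `1 − (1 − 1/D)^P`, which in
turn is at least `1 − e^{−P/D}`. -/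
theorem wolsey_inequality (P D : ℕ) (hP : 0 < P) (hD : 0 < D)
    (ρ : ℕ → ℝ) (hnn : ∀ i ∈ Finset.Icc 1 P, 0 ≤ ρ i) (h1 : 0 < ρ 1) :
    1 - (1 - 1 / (D : ℝ)) ^ P ≤
      (∑ i ∈ Finset.Icc 1 P, ρ i) /
        ((Finset.Icc 1 P).inf' (Finset.nonempty_Icc.mpr hP)
          (fun t => (∑ i ∈ Finset.Icc 1 (t - 1), ρ i) + (D : ℝ) * ρ t)) ∧
    1 - Real.exp (-(P : ℝ) / (D : ℝ)) ≤ 1 - (1 - 1 / (D : ℝ)) ^ P := by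
  have hD1 : (1 : ℝ) ≤ D := by exact_mod_cast hD
  have hD0 : (0 : ℝ) < D := by linarith
  refine ⟨?_, ?_⟩
  · rw [le_div_iff₀, mul_comm]
    · refine mul_one_sub_pow_le_sum_Icc hD1 ρ P fun t ht => ?_
      exact Finset.inf'_le (fun t => (∑ i ∈ Finset.Icc 1 (t - 1), ρ i) + (D : ℝ) * ρ t)
        (Finset.mem_Icc.mpr ⟨t.succ_pos, ht⟩)
    · rw [Finset.lt_inf'_iff]
      intro t ht
      have hρt := mul_nonneg hD0.le (hnn t ht)
      rw [Finset.mem_Icc] at ht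
      rcases ht.1.eq_or_lt with rfl | h
      · simpa using mul_pos hD0 h1
      · refine add_pos_of_pos_of_nonneg (Finset.sum_pos' (fun i hi => hnn i ?_) ⟨1, ?_, h1⟩) hρt
        · rw [Finset.mem_Icc] at hi ⊢
          lia
        · rw [Finset.mem_Icc]
          lia
  · have hq : 0 ≤ 1 - 1 / (D : ℝ) := by
      rw [sub_nonneg, div_le_one hD0]
      exact hD1
    have hexp : Real.exp (-(P : ℝ) / D) = Real.exp (-(1 / (D : ℝ))) ^ P := by
      rw [← Real.exp_nat_mul]
      congr 1
      ring
    rw [hexp]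
    exact sub_le_sub_left (pow_le_pow_left₀ hq (Real.one_sub_le_exp_neg _) P) 1
end

section
/- Let f be a nonnegative monotone k-submodular function on 𝒮 over V = {1,…,n} with f(∅) = 0. Let S be constructed greedily: starting from S_0 = ∅, for a = 1,…,n choose an index i_a ∈ argmax_{i∈[k]} Δ_{a,i}(S_{a−1}) and set S_a = S_{a−1} ∪ {(a,i_a)}; let S = S_n. Then for every T ∈ 𝒮 one has f(T) ≤ 2·f(S); in particular, S is a 1/2-approximation to the unconstrained maximum of f. -/
/-!  Common setup: a `k`-disjoint solution over a ground set `V` is encoded as a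
function `V → Option (Fin k)`, where `x a = some i` means item `a` lies in the
`i`-th set `X_i`, and `x a = none` means `a` is not selected.  -/

/-- The operation `x ⊔ y`: item `a` keeps label `i` iff all labels assigned to `a`
by `x` and `y` equal `i`. -/
def ksup {V : Type*} {k : ℕ} (x y : V → Option (Fin k)) : V → Option (Fin k) :=
  fun a =>
    match x a, y a with
    | none, o => o
    | some i, none => some i
    | some i, some j => if i = j then some i else none

/-- The operation `x ⊓ y`: componentwise intersection. -/
def kinf {V : Type*} {k : ℕ} (x y : V → Option (Fin k)) : V → Option (Fin k) :=
  fun a => if x a = y a then x a else none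

/-- `f` is `k`-submodular. -/
def KSubmodular {V : Type*} {k : ℕ} (f : (V → Option (Fin k)) → ℝ) : Prop :=
  ∀ x y, f (ksup x y) + f (kinf x y) ≤ f x + f y

/-- `f` is monotone: enlarging each component (keeping labels) does not decrease `f`. -/
def KMonotone {V : Type*} {k : ℕ} (f : (V → Option (Fin k)) → ℝ) : Prop :=
  ∀ x y : V → Option (Fin k), (∀ a i, x a = some i → y a = some i) → f x ≤ f y

/-- Marginal gains of a `k`-submodular function decrease as the solution grows. -/
theorem KSubmodular.marginal_le {V : Type*} [DecidableEq V] {k : ℕ}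
    {f : (V → Option (Fin k)) → ℝ} (hf : KSubmodular f) {x z : V → Option (Fin k)}
    (hxz : ∀ b i, x b = some i → z b = some i) {a : V} (hz : z a = none) (i : Fin k) :
    f (Function.update z a (some i)) - f z ≤ f (Function.update x a (some i)) - f x := by
  have hx : x a = none := by
    cases h : x a with
    | none => rfl
    | some j => simp [hxz a j h] at hz
  have hsup : ksup (Function.update x a (some i)) z = Function.update z a (some i) := by
    funext b
    by_cases hb : b = a
    · subst hb
      simp [ksup, hz]
    · cases h : x b with
      | none => simp [ksup, hb, h]
      | some j => simp [ksup, hb, h, hxz b j h]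
  have hinf : kinf (Function.update x a (some i)) z = x := by
    funext b
    by_cases hb : b = a
    · subst hb
      simp [kinf, hz, hx]
    · cases h : x b with
      | none => simp [kinf, hb, h]
      | some j => simp [kinf, hb, h, hxz b j h]
  have h := hf (Function.update x a (some i)) z
  rw [hsup, hinf] at h
  linarith

/-- **Theorem 2.1 (Ward–Živný).**  The unconstrained greedy algorithm, which considers
the items `0, 1, …, n−1` of `V = Fin n` in order and assigns to each item an index with
the largest marginal gain, is a `1/2`-approximation: every solution `T` satisfies
`f(T) ≤ 2·f(S)` for the greedy solution `S = Sseq n`. -/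
theorem greedy_half_approximation {n k : ℕ} (hk : 0 < k)
    (f : (Fin n → Option (Fin k)) → ℝ)
    (hsub : KSubmodular f) (hmono : KMonotone f) (hnn : ∀ x, 0 ≤ f x)
    (hzero : f (fun _ => none) = 0)
    (Sseq : ℕ → Fin n → Option (Fin k))
    (hS0 : Sseq 0 = fun _ => none)
    (ia : Fin n → Fin k)
    (hstep : ∀ a : Fin n, Sseq ((a : ℕ) + 1) = Function.update (Sseq (a : ℕ)) a (some (ia a)))
    (hgreedy : ∀ a : Fin n, ∀ i : Fin k,
      f (Function.update (Sseq (a : ℕ)) a (some i)) - f (Sseq (a : ℕ)) ≤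
        f (Function.update (Sseq (a : ℕ)) a (some (ia a))) - f (Sseq (a : ℕ)))
    (T : Fin n → Option (Fin k)) :
    f T ≤ 2 * f (Sseq n) := by
  have hS : ∀ j ≤ n, Sseq j = fun b : Fin n => if (b : ℕ) < j then some (ia b) else none := by
    intro j
    induction j with
    | zero => simp [hS0]
    | succ j ih =>
      intro hj
      rw [hstep ⟨j, hj⟩, ih (by omega)]
      funext b
      by_cases hb : b = ⟨j, hj⟩
      · subst hb
        simp
      · have hbj : (b : ℕ) ≠ j := fun h => hb (Fin.ext h)
        simp [hb, Order.lt_add_one_iff, Nat.le_iff_lt_or_eq, hbj]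
  have key : ∀ j ≤ n,
      f T ≤ f (fun b : Fin n => if (b : ℕ) < j then some (ia b) else T b) + f (Sseq j) := by
    intro j
    induction j with
    | zero => simp [hS0, hzero]
    | succ j ih =>
      intro hj
      have ih := ih (by omega)
      set a : Fin n := ⟨j, hj⟩
      set y : Fin n → Option (Fin k) := fun b => if (b : ℕ) < j then some (ia b) else T b
        with hy
      have hya : y a = T a := by simp [hy, a]
      have hnext : (fun b : Fin n => if (b : ℕ) < j + 1 then some (ia b) else T b)
          = Function.update y a (some (ia a)) := by
        funext b
        by_cases hb : b = a
        · subst hb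
          simp [a]
        · have hbj : (b : ℕ) ≠ j := fun h => hb (Fin.ext h)
          simp [hb, hy, Order.lt_add_one_iff, Nat.le_iff_lt_or_eq, hbj]
      have hSa : Sseq j a = none := by simp [hS j (by omega), a]
      have hdrop : f (Function.update y a none) ≤ f (Function.update y a (some (ia a))) := by
        apply hmono
        intro b i
        by_cases hb : b = a
        · subst hb
          simp
        · simp [hb]
      have hstep' : Sseq (j + 1) = Function.update (Sseq j) a (some (ia a)) := hstep a
      rw [hnext, hstep']
      cases hT : T a with
      | none =>
        have hyy : Function.update y a none = y := by
          rw [← hT, ← hya, Function.update_eq_self]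
        have hgrow : f (Sseq j) ≤ f (Function.update (Sseq j) a (some (ia a))) := by
          apply hmono
          intro b i
          by_cases hb : b = a
          · subst hb
            simp [hSa]
          · simp [hb]
        rw [hyy] at hdrop
        linarith
      | some i =>
        have hle : ∀ b l, Sseq j b = some l → Function.update y a none b = some l := by
          intro b l hbl
          have hb : b ≠ a := by
            rintro rfl
            simp [hSa] at hbl
          rw [hS j (by omega)] at hbl
          by_cases hbj : (b : ℕ) < j
          · simpa [hb, hy, hbj] using hbl
          · simp [hbj] at hbl
        have hm := hsub.marginal_le hle (Function.update_self a none y) i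
        have hyy : Function.update (Function.update y a none) a (some i) = y := by
          rw [Function.update_idem, ← hT, ← hya, Function.update_eq_self]
        rw [hyy] at hm
        have hg : f (Function.update (Sseq j) a (some i)) - f (Sseq j) ≤
            f (Function.update (Sseq j) a (some (ia a))) - f (Sseq j) := hgreedy a i
        linarith
  have hlast : (fun b : Fin n => if (b : ℕ) < n then some (ia b) else T b) = Sseq n := by
    rw [hS n le_rfl]
    funext b
    simp
  have h := key n le_rfl
  rw [hlast] at h
  linarith
end

section
/- For monotone functions, orthant submodularity implies k-submodularity: if f:𝒮→ℝ is monotone and satisfies Δ_{a,i}(x) ≥ Δ_{a,i}(y) for all x ⪯ y in 𝒮, all a ∉ ⋃_{j∈[k]} Y_j and all i ∈ [k], then f is k-submodular, i.e., f(x)+f(y) ≥ f(x⊔y)+f(x⊓y) for all x,y ∈ 𝒮. -/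
/-- Orthant submodularity extends from single items to finite sets of items. -/
lemma sub_le_sub_piecewise_of_orthant
    {V : Type*} [DecidableEq V] {k : ℕ} (f : (V → Option (Fin k)) → ℝ)
    (horth : ∀ x y : V → Option (Fin k), (∀ a i, x a = some i → y a = some i) →
      ∀ a, y a = none → ∀ i : Fin k,
        f (Function.update y a (some i)) - f y ≤
          f (Function.update x a (some i)) - f x)
    (p q o : V → Option (Fin k)) (hpq : ∀ a i, p a = some i → q a = some i)
    (s : Finset V) (hs : ∀ a ∈ s, q a = none) :
    f (s.piecewise o q) - f q ≤ f (s.piecewise o p) - f p := by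
  induction s using Finset.induction_on with
  | empty => simp
  | insert a s ha ih =>
    have ih' := ih fun b hb => hs b (Finset.mem_insert_of_mem hb)
    have hqa : q a = none := hs a (Finset.mem_insert_self a s)
    have hpa : p a = none := by
      cases h : p a with
      | none => rfl
      | some i => simp [hpq a i h] at hqa
    have hq : s.piecewise o q a = none := by simp [ha, hqa]
    have hp : s.piecewise o p a = none := by simp [ha, hpa]
    rw [Finset.piecewise_insert, Finset.piecewise_insert]
    cases ho : o a with
    | none =>
      rw [Function.update_eq_self_iff.2 hq.symm, Function.update_eq_self_iff.2 hp.symm]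
      exact ih'
    | some i =>
      have hle : ∀ b j, s.piecewise o p b = some j → s.piecewise o q b = some j := by
        intro b j
        by_cases hb : b ∈ s
        · simp [hb]
        · simpa [hb] using hpq b j
      linarith [horth _ _ hle a hq i]

/-- For monotone functions, orthant submodularity implies `k`-submodularity
(Ward–Živný): if `f` is monotone and `Δ_{a,i}(x) ≥ Δ_{a,i}(y)` whenever `x ⪯ y`,
`a` is unassigned in `y`, and `i ∈ [k]`, then `f` is `k`-submodular. -/
theorem monotone_orthant_submodular_implies_ksubmodular
    {V : Type*} [Fintype V] [DecidableEq V] {k : ℕ}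
    (f : (V → Option (Fin k)) → ℝ) (hmono : KMonotone f)
    (horth : ∀ x y : V → Option (Fin k), (∀ a i, x a = some i → y a = some i) →
      ∀ a, y a = none → ∀ i : Fin k,
        f (Function.update y a (some i)) - f y ≤
          f (Function.update x a (some i)) - f x) :
    KSubmodular f := by
  intro x y
  let y' : V → Option (Fin k) := fun a => if x a = none ∨ x a = y a then y a else none
  let s : Finset V := Finset.univ.filter fun a => y a = none
  have hle : ∀ a i, kinf x y a = some i → y' a = some i := by
    intro a i
    simp only [kinf, y']
    grind
  have hs : ∀ a ∈ s, y' a = none := by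
    intro a ha
    simp only [s, Finset.mem_filter] at ha
    simp [y', ha.2]
  have hsup : s.piecewise x y' = ksup x y := by
    funext a
    cases hx : x a <;> cases hy : y a <;> simp [s, y', ksup, Finset.piecewise, hx, hy]
    grind
  have hy : f y' ≤ f y := hmono _ _ fun a i => by
    simp only [y']
    grind
  have hx : f (s.piecewise x (kinf x y)) ≤ f x := hmono _ _ fun a i => by
    simp only [Finset.piecewise, kinf]
    grind
  have key := sub_le_sub_piecewise_of_orthant f horth _ _ x hle s hs
  rw [hsup] at key
  linarith
end

section
/- Let f be a nonnegative monotone k-submodular function on 𝒮, and let T = {(a*_1,i*_1),…,(a*_m,i*_m)} ∈ 𝒮 with m ≥ 3 be ordered so that for every t = 1,…,m, f(T^t) = max_{(a,i) ∈ T∖T^{t−1}} f(T^{t−1} ∪ {(a,i)}), where T^t = {(a*_1,i*_1),…,(a*_t,i*_t)} and T^0 = ∅. Let Y = T^3. Then for every j with 4 ≤ j ≤ m and every Z ∈ 𝒮 with U(Z) ∩ {a*_1, a*_2, a*_3, a*_j} = ∅, one has f(Y ∪ Z ∪ {(a*_j,i*_j)}) − f(Y ∪ Z) ≤ f(Y)/3.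 -/
/-- Diminishing returns: the marginal gain of a new pair does not increase when the
current solution is enlarged. -/
theorem KSubmodular.marginal_antitone {V : Type*} [DecidableEq V] {k : ℕ}
    {f : (V → Option (Fin k)) → ℝ} (hf : KSubmodular f)
    {x y : V → Option (Fin k)} (hxy : ∀ b l, x b = some l → y b = some l)
    {c : V} (hc : y c = none) (l : Fin k) :
    f (Function.update y c (some l)) - f y ≤ f (Function.update x c (some l)) - f x := by
  have hxc : x c = none := by
    cases h : x c with
    | none => rfl
    | some l' => simp [hxy c l' h] at hc
  have hsup : ksup (Function.update x c (some l)) y = Function.update y c (some l) := by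
    funext b
    by_cases hb : b = c
    · subst hb
      simp [ksup, hc]
    · cases h : x b with
      | none => simp [ksup, hb, h]
      | some l' => simp [ksup, hb, h, hxy b l' h]
  have hinf : kinf (Function.update x c (some l)) y = x := by
    funext b
    by_cases hb : b = c
    · subst hb
      simp [kinf, hc, hxc]
    · cases h : x b with
      | none => simp [kinf, hb, h]
      | some l' => simp [kinf, hb, h, hxy b l' h]
  have h := hf (Function.update x c (some l)) y
  rw [hsup, hinf] at h
  linarith

/-- **Inequality (3).**  Let `T` consist of the distinct items `a 0, …, a (m−1)`
(`m ≥ 3`) with indices `i 0, …, i (m−1)`, ordered greedily by value: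
`f(T^t) = max_{(a,i) ∈ T∖T^{t−1}} f(T^{t−1} ∪ {(a,i)})`, where `Tseq t = T^t` is the
set of the first `t` pairs.  Let `Y = T^3` be the first three pairs.  Then for every
later pair `(a j, i j)` (so `3 ≤ j < m`, i.e. `4 ≤ j+1 ≤ m` in 1-based counting) and
every solution `Z` avoiding the items `a 0, a 1, a 2, a j`, one has
`f(Y ∪ Z ∪ {(a j, i j)}) − f(Y ∪ Z) ≤ f(Y)/3`. -/
theorem marginal_gain_le_third_of_top_three
    {V : Type*} [Fintype V] [DecidableEq V] {k : ℕ}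
    (f : (V → Option (Fin k)) → ℝ)
    (hsub : KSubmodular f) (hmono : KMonotone f) (hnn : ∀ x, 0 ≤ f x)
    (m : ℕ) (hm : 3 ≤ m)
    (a : ℕ → V) (i : ℕ → Fin k)
    (hinj : ∀ s t, s < m → t < m → a s = a t → s = t)
    (Tseq : ℕ → V → Option (Fin k))
    (hT0 : Tseq 0 = fun _ => none)
    (hTstep : ∀ t < m, Tseq (t + 1) = Function.update (Tseq t) (a t) (some (i t)))
    (horder : ∀ t < m, ∀ j, t ≤ j → j < m →
      f (Function.update (Tseq t) (a j) (some (i j))) ≤ f (Tseq (t + 1)))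
    (j : ℕ) (hj3 : 3 ≤ j) (hjm : j < m)
    (Z : V → Option (Fin k))
    (hZ0 : Z (a 0) = none) (hZ1 : Z (a 1) = none) (hZ2 : Z (a 2) = none)
    (hZj : Z (a j) = none) :
    f (Function.update (ksup (Tseq 3) Z) (a j) (some (i j))) - f (ksup (Tseq 3) Z) ≤
      f (Tseq 3) / 3 := by
  have h1 := hTstep 0 (by omega)
  have h2 := hTstep 1 (by omega)
  have h3 := hTstep 2 (by omega)
  norm_num only at h1 h2 h3
  have ne : ∀ s t, s < m → t < m → s ≠ t → a s ≠ a t :=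
    fun s t hs ht hst h => hst (hinj s t hs ht h)
  have n01 := ne 0 1 (by omega) (by omega) (by omega)
  have n02 := ne 0 2 (by omega) (by omega) (by omega)
  have n12 := ne 1 2 (by omega) (by omega) (by omega)
  have nj0 := ne j 0 (by omega) (by omega) (by omega)
  have nj1 := ne j 1 (by omega) (by omega) (by omega)
  have nj2 := ne j 2 (by omega) (by omega) (by omega)
  have hle2 : ∀ b l, Tseq 2 b = some l → Tseq 3 b = some l := by
    intro b l hb
    by_cases hb2 : b = a 2
    · subst hb2
      simp [h2, h1, hT0, n02.symm, n12.symm] at hb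
    · simpa [h3, hb2] using hb
  have hle1 : ∀ b l, Tseq 1 b = some l → Tseq 2 b = some l := by
    intro b l hb
    by_cases hb1 : b = a 1
    · subst hb1
      simp [h1, hT0, n01.symm] at hb
    · simpa [h2, hb1] using hb
  have hle3 : ∀ b l, Tseq 3 b = some l → ksup (Tseq 3) Z b = some l := by
    intro b l hb
    have hZ : Z b = none := by
      by_cases b2 : b = a 2
      · rwa [b2]
      by_cases b1 : b = a 1
      · rwa [b1]
      by_cases b0 : b = a 0
      · rwa [b0]
      simp [h3, h2, h1, hT0, b0, b1, b2] at hb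
    simp [ksup, hb, hZ]
  have hc : ksup (Tseq 3) Z (a j) = none := by
    simp [ksup, h3, h2, h1, hT0, nj0, nj1, nj2, hZj]
  have g0 := hsub.marginal_antitone (x := Tseq 0) (by simp [hT0]) hc (i j)
  have g1 := hsub.marginal_antitone
    (fun b l h => hle3 b l (hle2 b l (hle1 b l h))) hc (i j)
  have g2 := hsub.marginal_antitone (fun b l h => hle3 b l (hle2 b l h)) hc (i j)
  have o0 := horder 0 (by omega) j (by omega) hjm
  have o1 := horder 1 (by omega) j (by omega) hjm
  have o2 := horder 2 (by omega) j (by omega) hjm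
  norm_num only at o0 o1 o2
  linarith [hnn (Tseq 0)]
end

section
/- Let f be a nonnegative monotone k-submodular function on 𝒮 over V = {1,…,n} with f(∅) = 0, let c_a be a positive integer cost for each a ∈ V, and let B be a positive integer budget; call S ∈ 𝒮 feasible if c(S) := Σ_{a∈U(S)} c_a ≤ B. Let S_A be the output of the following algorithm: initialize S_A as a feasible solution of size at most 2 maximizing f among all feasible solutions with |U(S)| ≤ 2; then, for every feasible I ∈ 𝒮 with |U(I)| = 3, run the density greedy from S^0 = I and V^0 = V∖U(I): at each step t = 1,…,n, let (a_t,i_t) attain θ_t = max_{a ∈ V^{t−1}, i ∈ [k]} Δ_{a,i}(S^{t−1})/c_a, set S^t = S^{t−1} ∪ {(a_t,i_t)} if c(S^{t−1}) + c_{a_t} ≤ B and S^t = S^{t−1} otherwise, and set V^t = V^{t−1}∖{a_t}; replace S_A by S^n whenever f(S^n) > f(S_A). Then for every feasible T ∈ 𝒮, f(S_A) ≥ (1/2 − 1/(2e))·f(T); that is, the algorithm is a (1/2 − 1/(2e))-approximation for maximizing f under the knapsack constraint. -/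
/-- Number of items used by a solution. -/
def solSize {n k : ℕ} (S : Fin n → Option (Fin k)) : ℕ :=
  (Finset.univ.filter (fun a => S a ≠ none)).card

/-- Total cost of the items used by a solution. -/
def solCost {n k : ℕ} (c : Fin n → ℕ) (S : Fin n → Option (Fin k)) : ℕ :=
  ∑ a ∈ Finset.univ.filter (fun a => S a ≠ none), c a

/-- `DensityGreedyRun f c B I Sout` means `Sout` is a possible output of the
density-greedy procedure (lines 3–10 of Algorithm 2) started from `S^0 = I` and
`V^0 = V ∖ U(I)`: at each step `t = 1, …, n` (as long as candidates remain), a pair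
`(a_t, i_t)` maximizing the density `Δ_{a,i}(S^{t−1})/c_a` over `a ∈ V^{t−1}`,
`i ∈ [k]` is chosen; it is added to `S^{t−1}` if the budget `B` permits, and `a_t`
is removed from the candidate set; the output is `S^n`. -/
def DensityGreedyRun {n k : ℕ} (f : (Fin n → Option (Fin k)) → ℝ)
    (c : Fin n → ℕ) (B : ℕ) (I Sout : Fin n → Option (Fin k)) : Prop :=
  ∃ (Sseq : ℕ → Fin n → Option (Fin k)) (Vseq : ℕ → Finset (Fin n)),
    Sseq 0 = I ∧
    Vseq 0 = Finset.univ.filter (fun a => I a = none) ∧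
    (∀ t, 1 ≤ t → t ≤ n →
      ((Vseq (t - 1) = ∅ ∧ Sseq t = Sseq (t - 1) ∧ Vseq t = Vseq (t - 1)) ∨
        (∃ at_ ∈ Vseq (t - 1), ∃ it_ : Fin k,
          (∀ a ∈ Vseq (t - 1), ∀ i : Fin k,
            (f (Function.update (Sseq (t - 1)) a (some i)) - f (Sseq (t - 1))) / (c a : ℝ) ≤
              (f (Function.update (Sseq (t - 1)) at_ (some it_)) - f (Sseq (t - 1))) /
                (c at_ : ℝ)) ∧
          (if solCost c (Sseq (t - 1)) + c at_ ≤ B then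
              Sseq t = Function.update (Sseq (t - 1)) at_ (some it_)
            else Sseq t = Sseq (t - 1)) ∧
          Vseq t = Vseq (t - 1) \ {at_}))) ∧
    Sout = Sseq n

section KSubmodularLemmas

variable {V : Type*} [DecidableEq V] {k : ℕ} {f : (V → Option (Fin k)) → ℝ}

/-- `KExtends x y` says that `y` keeps every label assigned by `x`. -/
def KExtends (x y : V → Option (Fin k)) : Prop :=
  ∀ a i, x a = some i → y a = some i

/-- The solution `S` completed by the labels of `T` on the items unused by `S`. -/
def overlay (S T : V → Option (Fin k)) : V → Option (Fin k) :=
  fun a => (S a).or (T a)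

omit [DecidableEq V] in
lemma kExtends_overlay (S T : V → Option (Fin k)) : KExtends S (overlay S T) := by
  intro a i h
  simp [overlay, h]

omit [DecidableEq V] in
lemma overlay_eq_right {S T : V → Option (Fin k)} (h : KExtends S T) : overlay S T = T := by
  funext a
  cases hS : S a with
  | none => simp [overlay, hS]
  | some i => simp [overlay, hS, h a i hS]

omit [DecidableEq V] in
lemma KExtends.trans {x y z : V → Option (Fin k)} (hxy : KExtends x y) (hyz : KExtends y z) :
    KExtends x z :=
  fun a i h => hyz a i (hxy a i h)

lemma kExtends_update {S : V → Option (Fin k)} {a : V} (ha : S a = none) (o : Option (Fin k)) :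
    KExtends S (Function.update S a o) := by
  intro b i hb
  have hne : b ≠ a := by rintro rfl; simp [ha] at hb
  rwa [Function.update_of_ne hne]

/-- Marginal gains of a `k`-submodular function decrease as the solution grows. -/
lemma KSubmodular.marginal_antitone_s8 (hsub : KSubmodular f) {S R : V → Option (Fin k)}
    (hSR : KExtends S R) {a : V} (ha : R a = none) (o : Option (Fin k)) :
    f (Function.update R a o) - f R ≤ f (Function.update S a o) - f S := by
  have hSa : S a = none := by
    cases h : S a with
    | none => rfl
    | some i => simp [hSR a i h] at ha
  have hsup : ksup (Function.update S a o) R = Function.update R a o := by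
    funext b
    by_cases hb : b = a
    · subst hb
      cases o <;> simp [ksup, ha]
    · cases h : S b with
      | none => simp [ksup, hb, h]
      | some i => simp [ksup, hb, h, hSR b i h]
  have hinf : kinf (Function.update S a o) R = S := by
    funext b
    by_cases hb : b = a
    · subst hb
      cases o <;> simp [kinf, ha, hSa]
    · cases h : S b with
      | none => simp [kinf, hb, h]
      | some i => simp [kinf, hb, h, hSR b i h]
  have := hsub (Function.update S a o) R
  rw [hsup, hinf] at this
  linarith

/-- Extending `S` on a set of unused items gains at most the sum of the marginal gains. -/
lemma KSubmodular.le_add_sum_marginals (hsub : KSubmodular f) (S T : V → Option (Fin k))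
    (A : Finset V) (hA : ∀ a ∈ A, S a = none) :
    f (fun a => if a ∈ A then T a else S a) - f S ≤
      ∑ a ∈ A, (f (Function.update S a (T a)) - f S) := by
  induction A using Finset.induction_on with
  | empty => simp
  | insert b A hb ih =>
    rw [Finset.sum_insert hb]
    have ih := ih fun a ha => hA a (Finset.mem_insert_of_mem ha)
    have hext : KExtends S (fun a => if a ∈ A then T a else S a) := by
      intro a i h
      have : a ∉ A := fun ha => by simp [hA a (Finset.mem_insert_of_mem ha)] at h
      simpa [this] using h
    have hbn : (fun a => if a ∈ A then T a else S a) b = none := by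
      simpa [hb] using hA b (Finset.mem_insert_self b A)
    have hupd : (fun a => if a ∈ insert b A then T a else S a) =
        Function.update (fun a => if a ∈ A then T a else S a) b (T b) := by
      funext a
      by_cases h : a = b
      · subst h; simp
      · simp [h]
    have := hsub.marginal_antitone_s8 hext hbn (T b)
    rw [hupd]
    linarith

/-- Adding an item with its best label to `S` decreases the value of the overlay of `T`
by at most the gain in `f`. -/
lemma KSubmodular.overlay_add_le (hsub : KSubmodular f) (hmono : KMonotone f)
    {S T : V → Option (Fin k)} {a : V} {i : Fin k} (ha : S a = none)
    (hmax : ∀ j, f (Function.update S a (some j)) ≤ f (Function.update S a (some i))) :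
    f (overlay S T) + f S ≤
      f (overlay (Function.update S a (some i)) T) + f (Function.update S a (some i)) := by
  have hle : f (Function.update (overlay S T) a none) ≤
      f (overlay (Function.update S a (some i)) T) := by
    refine hmono _ _ fun b j hb => ?_
    by_cases h : b = a
    · subst h; simp at hb
    · simpa [overlay, h] using hb
  cases hT : T a with
  | none =>
    have hself : Function.update (overlay S T) a none = overlay S T := by
      refine Function.update_eq_self_iff.2 ?_
      simp [overlay, ha, hT]
    rw [hself] at hle
    linarith [hmono _ _ (kExtends_update ha (some i))]
  | some j =>
    have hext : KExtends S (Function.update (overlay S T) a none) := by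
      intro b l hb
      have hne : b ≠ a := by rintro rfl; simp [ha] at hb
      simp [hne, overlay, hb]
    have hanti := hsub.marginal_antitone_s8 (a := a) hext (by simp) (some j)
    have hself : Function.update (Function.update (overlay S T) a none) a (some j) =
        overlay S T := by
      rw [Function.update_idem]
      refine Function.update_eq_self_iff.2 ?_
      simp [overlay, ha, hT]
    rw [hself] at hanti
    linarith [hmax j]

end KSubmodularLemmas

section DensityGreedy

variable {n k : ℕ} {f : (Fin n → Option (Fin k)) → ℝ} {c : Fin n → ℕ} {B : ℕ}
  {I T : Fin n → Option (Fin k)}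

/-- The solution consisting of the item `a` with its label in `T`. -/
def singleItem (T : Fin n → Option (Fin k)) (a : Fin n) : Fin n → Option (Fin k) :=
  Function.update (fun _ => none) a (T a)

lemma solCost_update {S : Fin n → Option (Fin k)} {a : Fin n} (ha : S a = none) (i : Fin k) :
    solCost c (Function.update S a (some i)) = solCost c S + c a := by
  have : Finset.univ.filter (fun b => Function.update S a (some i) b ≠ none) =
      insert a (Finset.univ.filter (fun b => S b ≠ none)) := by
    ext b
    by_cases h : b = a
    · subst h; simp
    · simp [h]
  rw [solCost, this, Finset.sum_insert (by simp [ha]), solCost, add_comm]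

lemma solCost_add_sum_le (hIT : KExtends I T) (hT : solCost c T ≤ B) (A : Finset (Fin n))
    (hA : ∀ a ∈ A, I a = none ∧ T a ≠ none) : solCost c I + ∑ a ∈ A, c a ≤ B := by
  have hdisj : Disjoint (Finset.univ.filter (fun a => I a ≠ none)) A :=
    Finset.disjoint_left.2 fun a ha ha' => by simp [(hA a ha').1] at ha
  refine le_trans ?_ hT
  rw [solCost, ← Finset.sum_union hdisj, solCost]
  refine Finset.sum_le_sum_of_subset fun a ha => ?_
  rcases Finset.mem_union.1 ha with ha | ha
  · obtain ⟨i, hi⟩ := Option.ne_none_iff_exists'.1 (Finset.mem_filter.1 ha).2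
    simp [hIT a i hi]
  · simp [(hA a ha).2]

/-- If every unused item of `T` has density at most `θ`, then completing `S` by `T` gains at
most `θ` times the remaining budget, with one item `b` charged by its own value instead. -/
lemma overlay_gain_le (hsub : KSubmodular f) (hzero : f (fun _ => none) = 0)
    (hIT : KExtends I T) (hT : solCost c T ≤ B) {S : Fin n → Option (Fin k)}
    (hIS : KExtends I S) {θ : ℝ} (hθ : 0 ≤ θ)
    (hdens : ∀ a, S a = none → T a ≠ none → f (Function.update S a (T a)) - f S ≤ θ * c a)
    {b : Fin n} (hSb : S b = none) (hTb : T b ≠ none) :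
    f (overlay S T) - f S ≤
      θ * ((B : ℝ) - solCost c I - c b) + f (singleItem T b) := by
  set A := Finset.univ.filter (fun a => S a = none ∧ T a ≠ none) with hA
  have hover : overlay S T = fun a => if a ∈ A then T a else S a := by
    funext a
    cases h : S a <;> cases h' : T a <;> simp [overlay, hA, h, h']
  have hsum := hsub.le_add_sum_marginals S T A fun a ha => (Finset.mem_filter.1 ha).2.1
  have hbA : b ∈ A := by simp [hA, hSb, hTb]
  rw [← hover, ← Finset.add_sum_erase A _ hbA] at hsum
  have hsingle : f (Function.update S b (T b)) - f S ≤ f (singleItem T b) := by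
    have := hsub.marginal_antitone_s8 (S := fun _ => none) (R := S) (fun a i h => by simp at h)
      hSb (T b)
    rw [hzero, sub_zero] at this
    exact this
  have hrest : ∑ a ∈ A.erase b, (f (Function.update S a (T a)) - f S) ≤
      θ * ∑ a ∈ A.erase b, (c a : ℝ) := by
    rw [Finset.mul_sum]
    refine Finset.sum_le_sum fun a ha => ?_
    have := (Finset.mem_filter.1 (Finset.mem_of_mem_erase ha)).2
    exact hdens a this.1 this.2
  have hcost : solCost c I + ∑ a ∈ A, c a ≤ B := by
    refine solCost_add_sum_le hIT hT A fun a ha => ?_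
    have := (Finset.mem_filter.1 ha).2
    refine ⟨?_, this.2⟩
    cases h : I a with
    | none => rfl
    | some i => simp [hIS a i h] at this
  rw [← Finset.add_sum_erase A _ hbA] at hcost
  have hcost' : (solCost c I : ℝ) + (c b + ∑ a ∈ A.erase b, (c a : ℝ)) ≤ B := by
    exact_mod_cast hcost
  have := mul_le_mul_of_nonneg_left
    (show ∑ a ∈ A.erase b, (c a : ℝ) ≤ (B : ℝ) - solCost c I - c b by linarith) hθ
  linarith

/-- The state of the density greedy started from `I`, as long as no item of `T` has been
rejected: `S` is the current solution, `W` the set of candidates and `m` bounds its size. -/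
structure GreedyInvariant (f : (Fin n → Option (Fin k)) → ℝ) (c : Fin n → ℕ) (B : ℕ)
    (I T S : Fin n → Option (Fin k)) (W : Finset (Fin n)) : Prop where
  kExtends : KExtends I S
  mem_candidates : ∀ a, T a ≠ none → S a = none → a ∈ W
  overlay_le : f T + f I ≤ f (overlay S T) + f S
  decay : ∀ b ∈ W, T b ≠ none →
    0 ≤ f T - f I - f (singleItem T b) → 0 < (B : ℝ) - solCost c I - c b →
    f T - f I - f (singleItem T b) - 2 * (f S - f I) ≤
      (f T - f I - f (singleItem T b)) *
        Real.exp (-(((solCost c S : ℝ) - solCost c I) / ((B : ℝ) - solCost c I - c b)))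

lemma exp_decay_step {X r r' D x w θ : ℝ} (hX : 0 ≤ X) (hD : 0 < D) (hw : 0 ≤ w) (hθ : 0 ≤ θ)
    (hr : r ≤ X * Real.exp (-(x / D))) (hrθ : r ≤ θ * D) (hr' : r' ≤ r - θ * w) :
    r' ≤ X * Real.exp (-((x + w) / D)) := by
  by_cases h : r < 0
  · have h1 : 0 ≤ θ * w := mul_nonneg hθ hw
    have h2 : 0 ≤ X * Real.exp (-((x + w) / D)) := by positivity
    linarith
  · push Not at h
    have h1 : r / D ≤ θ := (div_le_iff₀ hD).2 hrθ
    have h2 : r / D * w ≤ θ * w := mul_le_mul_of_nonneg_right h1 hw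
    have h3 : -(w / D) + 1 ≤ Real.exp (-(w / D)) := Real.add_one_le_exp _
    calc r' ≤ r * (-(w / D) + 1) := by
            have : r * (-(w / D) + 1) = r - r / D * w := by ring
            linarith
      _ ≤ r * Real.exp (-(w / D)) := mul_le_mul_of_nonneg_left h3 h
      _ ≤ X * Real.exp (-(x / D)) * Real.exp (-(w / D)) :=
            mul_le_mul_of_nonneg_right hr (Real.exp_pos _).le
      _ = X * Real.exp (-((x + w) / D)) := by
            rw [mul_assoc, ← Real.exp_add]
            congr 2
            ring

/-- Rejecting an item of `T` certifies the approximation guarantee. -/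
lemma GreedyInvariant.approx_of_reject (hmono : KMonotone f) (hnn : ∀ x, 0 ≤ f x)
    {S : Fin n → Option (Fin k)} {W : Finset (Fin n)} (h : GreedyInvariant f c B I T S W)
    (hsingle : ∀ a, T a ≠ none → f (singleItem T a) ≤ f I)
    {b : Fin n} (hbW : b ∈ W) (hTb : T b ≠ none) {θ : ℝ}
    (hgain : f (overlay S T) - f S ≤
      θ * ((B : ℝ) - solCost c I - c b) + f (singleItem T b))
    (hD : 0 ≤ (B : ℝ) - solCost c I - c b) (hrej : ¬ solCost c S + c b ≤ B) :
    (1 / 2 - 1 / (2 * Real.exp 1)) * f T ≤ f S := by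
  have hIS : f I ≤ f S := hmono _ _ h.kExtends
  have hb := hsingle b hTb
  have hT0 := hnn T
  have hov := h.overlay_le
  have hq : 1 / 2 - 1 / (2 * Real.exp 1) = (1 - Real.exp (-1)) / 2 := by
    rw [Real.exp_neg]
    field_simp
  rw [hq]
  have hE0 : 0 < Real.exp (-1) := Real.exp_pos _
  have hE1 : Real.exp (-1) < 1 := by simp
  set E := Real.exp (-1) with hE
  have hI0 := hnn I
  by_cases hX : 0 ≤ f T - f I - f (singleItem T b)
  · have hfinal : f T - f I - f (singleItem T b) - 2 * (f S - f I) ≤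
        (f T - f I - f (singleItem T b)) * E := by
      rcases hD.eq_or_lt with hD | hD
      · rw [← hD] at hgain
        have : 0 ≤ (f T - f I - f (singleItem T b)) * E := mul_nonneg hX hE0.le
        linarith
      · refine (h.decay b hbW hTb hX hD).trans (mul_le_mul_of_nonneg_left ?_ hX)
        refine Real.exp_le_exp.2 (neg_le_neg ((one_le_div hD).2 ?_))
        have : (B : ℝ) < solCost c S + c b := by exact_mod_cast not_le.1 hrej
        linarith
    nlinarith
  · push Not at hX
    nlinarith

/-- One step of the density greedy picking the pair `(a, i)`: the candidate `a` is removed, and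
it is added to the solution with label `i` if the budget permits. -/
lemma GreedyInvariant.step (hsub : KSubmodular f) (hmono : KMonotone f) (hnn : ∀ x, 0 ≤ f x)
    (hzero : f (fun _ => none) = 0) (hc : ∀ a, 0 < c a)
    (hIT : KExtends I T) (hT : solCost c T ≤ B)
    (hsingle : ∀ a, T a ≠ none → f (singleItem T a) ≤ f I)
    {S S' : Fin n → Option (Fin k)} {W : Finset (Fin n)} (h : GreedyInvariant f c B I T S W)
    (hW : ∀ a ∈ W, S a = none) {a : Fin n} (haW : a ∈ W) {i : Fin k}
    (hmax : ∀ b ∈ W, ∀ j : Fin k,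
      (f (Function.update S b (some j)) - f S) / (c b : ℝ) ≤
        (f (Function.update S a (some i)) - f S) / (c a : ℝ))
    (hS' : if solCost c S + c a ≤ B then S' = Function.update S a (some i) else S' = S) :
    (1 / 2 - 1 / (2 * Real.exp 1)) * f T ≤ f S' ∨ GreedyInvariant f c B I T S' (W \ {a}) := by
  have hc' : ∀ b, (0 : ℝ) < c b := fun b => by exact_mod_cast hc b
  have ha : S a = none := hW a haW
  set θ := (f (Function.update S a (some i)) - f S) / (c a : ℝ) with hθdef
  have hθ : 0 ≤ θ :=
    div_nonneg (sub_nonneg.2 (hmono _ _ (kExtends_update ha _))) (hc' a).le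
  have hθa : f (Function.update S a (some i)) - f S = θ * c a :=
    (div_mul_cancel₀ _ (hc' a).ne').symm
  have hdens : ∀ b, S b = none → T b ≠ none →
      f (Function.update S b (T b)) - f S ≤ θ * c b := by
    intro b hSb hTb
    obtain ⟨j, hj⟩ := Option.ne_none_iff_exists'.1 hTb
    rw [hj]
    exact (div_le_iff₀ (hc' b)).1 (hmax b (h.mem_candidates b hTb hSb) j)
  have hgain : ∀ b ∈ W, T b ≠ none → f (overlay S T) - f S ≤
      θ * ((B : ℝ) - solCost c I - c b) + f (singleItem T b) := fun b hb hTb =>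
    overlay_gain_le hsub hzero hIT hT h.kExtends hθ hdens (hW b hb) hTb
  by_cases hfit : solCost c S + c a ≤ B
  · rw [if_pos hfit] at hS'
    subst hS'
    have hbest : ∀ j, f (Function.update S a (some j)) ≤ f (Function.update S a (some i)) := by
      intro j
      have := (div_le_iff₀ (hc' a)).1 (hmax a haW j)
      linarith
    have hov := hsub.overlay_add_le hmono (T := T) ha hbest
    refine Or.inr ⟨h.kExtends.trans (kExtends_update ha _), fun b hTb hb => ?_,
      by linarith [h.overlay_le], fun b hb hTb hX hD => ?_⟩
    · have hne : b ≠ a := by rintro rfl; simp at hb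
      rw [Function.update_of_ne hne] at hb
      simp [hne, h.mem_candidates b hTb hb]
    · have hbW := (Finset.mem_sdiff.1 hb).1
      rw [solCost_update ha, Nat.cast_add, add_sub_right_comm]
      refine exp_decay_step hX hD (hc' a).le hθ (h.decay b hbW hTb hX hD) ?_ ?_
      · linarith [h.overlay_le, hgain b hbW hTb]
      · linarith [mul_nonneg hθ (hc' a).le]
  · rw [if_neg hfit] at hS'
    subst hS'
    by_cases hTa : T a = none
    · refine Or.inr ⟨h.kExtends, fun b hTb hb => ?_, h.overlay_le, fun b hb =>
        h.decay b (Finset.mem_sdiff.1 hb).1⟩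
      have hne : b ≠ a := by rintro rfl; exact hTb hTa
      simp [hne, h.mem_candidates b hTb hb]
    · refine Or.inl (h.approx_of_reject hmono hnn hsingle haW hTa (hgain a haW hTa) ?_ hfit)
      have hIa : I a = none := by
        cases hI : I a with
        | none => rfl
        | some j => simp [h.kExtends a j hI] at ha
      have := solCost_add_sum_le (c := c) hIT hT {a} (by simp [hIa, hTa])
      rw [Finset.sum_singleton] at this
      have : (solCost c I : ℝ) + c a ≤ B := by exact_mod_cast this
      linarith

/-- The density greedy started from a part `I` of `T` at least as valuable as each single item
of `T` achieves the approximation guarantee with respect to `T`. -/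
lemma DensityGreedyRun.approx (hsub : KSubmodular f) (hmono : KMonotone f)
    (hnn : ∀ x, 0 ≤ f x) (hzero : f (fun _ => none) = 0) (hc : ∀ a, 0 < c a)
    (hIT : KExtends I T) (hT : solCost c T ≤ B)
    (hsingle : ∀ a, T a ≠ none → f (singleItem T a) ≤ f I)
    {Sout : Fin n → Option (Fin k)} (hrun : DensityGreedyRun f c B I Sout) :
    (1 / 2 - 1 / (2 * Real.exp 1)) * f T ≤ f Sout := by
  obtain ⟨S, W, hS0, hW0, hstep, rfl⟩ := hrun
  have key : ∀ t, t ≤ n → (∀ a ∈ W t, S t a = none) ∧ (W t).card ≤ n - t ∧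
      ((1 / 2 - 1 / (2 * Real.exp 1)) * f T ≤ f (S t) ∨
        GreedyInvariant f c B I T (S t) (W t)) := by
    intro t
    induction t with
    | zero =>
      intro _
      rw [hS0, hW0]
      refine ⟨fun a ha => (Finset.mem_filter.1 ha).2,
        (Finset.card_le_univ _).trans (by simp), Or.inr ⟨fun _ _ => id, fun a _ ha => by simpa,
          by rw [overlay_eq_right hIT], fun b _ _ _ _ => by simp⟩⟩
    | succ t ih =>
      intro ht
      obtain ⟨hWt, hcard, hinv⟩ := ih (by omega)
      rcases hstep (t + 1) (by omega) ht with ⟨hemp, hS, hW⟩ | ⟨a, haW, i, hmax, hS, hW⟩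
      · rw [Nat.add_sub_cancel] at hemp hS hW
        rw [hS, hW]
        exact ⟨hWt, by simp [hemp], hinv⟩
      · rw [Nat.add_sub_cancel] at haW hmax hS hW
        have ha := hWt a haW
        refine ⟨fun b hb => ?_, ?_, ?_⟩
        · rw [hW, Finset.mem_sdiff, Finset.mem_singleton] at hb
          split_ifs at hS
          · rw [hS, Function.update_of_ne hb.2, hWt b hb.1]
          · rw [hS, hWt b hb.1]
        · rw [hW, Finset.card_sdiff_of_subset (by simpa using haW), Finset.card_singleton]
          omega
        · rcases hinv with hinv | hinv
          · refine Or.inl (hinv.trans ?_)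
            split_ifs at hS
            · rw [hS]
              exact hmono _ _ (kExtends_update ha _)
            · rw [hS]
          · rw [hW]
            exact hinv.step hsub hmono hnn hzero hc hIT hT hsingle hWt haW hmax hS
  obtain ⟨-, hcard, h | h⟩ := key n le_rfl
  · exact h
  · have hemp : W n = ∅ := by simpa using hcard
    have hover : overlay (S n) T = S n := by
      funext a
      cases hS : S n a with
      | some i => simp [overlay, hS]
      | none =>
        have : T a = none := by
          by_contra hTa
          simpa [hemp] using h.mem_candidates a hTa hS
        simp [overlay, hS, this]
    have hov := h.overlay_le
    rw [hover] at hov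
    have : 0 ≤ 1 / (2 * Real.exp 1) * f T := mul_nonneg (by positivity) (hnn T)
    linarith [hnn I]

end DensityGreedy

/-- **Theorem 3.1.**  Algorithm 2 is a `(1/2 − 1/(2e))`-approximation for maximizing a
nonnegative monotone `k`-submodular function `f` under a knapsack constraint: its
output `SA` — the `f`-best solution among a best feasible solution `S2` of size at
most `2` and the outputs `out I` of the density-greedy procedure started from every
feasible `I` of size `3` — satisfies `f(SA) ≥ (1/2 − 1/(2e))·f(T)` for every feasible
`T`. -/
theorem knapsack_greedy_approximation {n k : ℕ} (hk : 0 < k)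
    (f : (Fin n → Option (Fin k)) → ℝ)
    (hsub : KSubmodular f) (hmono : KMonotone f) (hnn : ∀ x, 0 ≤ f x)
    (hzero : f (fun _ => none) = 0)
    (c : Fin n → ℕ) (hc : ∀ a, 0 < c a) (B : ℕ) (hB : 0 < B)
    (SA S2 : Fin n → Option (Fin k))
    (out : (Fin n → Option (Fin k)) → (Fin n → Option (Fin k)))
    (hS2size : solSize S2 ≤ 2) (hS2cost : solCost c S2 ≤ B)
    (hS2max : ∀ S, solSize S ≤ 2 → solCost c S ≤ B → f S ≤ f S2)
    (hout : ∀ I, solSize I = 3 → solCost c I ≤ B → DensityGreedyRun f c B I (out I))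
    (hSAmem : SA = S2 ∨ ∃ I, solSize I = 3 ∧ solCost c I ≤ B ∧ SA = out I)
    (hSA2 : f S2 ≤ f SA)
    (hSAout : ∀ I, solSize I = 3 → solCost c I ≤ B → f (out I) ≤ f SA)
    (T : Fin n → Option (Fin k)) (hT : solCost c T ≤ B) :
    (1 / 2 - 1 / (2 * Real.exp 1)) * f T ≤ f SA := by
  by_cases hsize : solSize T ≤ 2
  · have h1 := hS2max T hsize hT
    have h2 : 0 ≤ 1 / (2 * Real.exp 1) * f T := mul_nonneg (by positivity) (hnn T)
    linarith [hnn T]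
  · push Not at hsize
    rw [solSize] at hsize
    obtain ⟨a₀, ha₀, hmax⟩ := Finset.exists_max_image
      (Finset.univ.filter (fun a => T a ≠ none)) (fun a => f (singleItem T a))
      (Finset.card_pos.1 (by omega))
    obtain ⟨A, haA, hAT, hA⟩ := Finset.exists_subsuperset_card_eq
      (Finset.singleton_subset_iff.2 ha₀) (n := 3) (by simp) (by omega)
    set I : Fin n → Option (Fin k) := fun a => if a ∈ A then T a else none with hI
    have hIT : KExtends I T := by
      intro a i h
      by_cases ha : a ∈ A
      · simpa [hI, ha] using h
      · simp [hI, ha] at h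
    have hUI : Finset.univ.filter (fun a => I a ≠ none) = A := by
      ext a
      have := fun h => (Finset.mem_filter.1 (hAT h : a ∈ _)).2
      simpa [hI] using this
    have hIsize : solSize I = 3 := by rw [solSize, hUI, hA]
    have hIcost : solCost c I ≤ B := by
      refine le_trans ?_ hT
      rw [solCost, hUI, solCost]
      exact Finset.sum_le_sum_of_subset hAT
    have hsingle : ∀ a, T a ≠ none → f (singleItem T a) ≤ f I := by
      intro a ha
      refine (hmax a (by simp [ha])).trans (hmono _ _ fun b i hb => ?_)
      by_cases h : b = a₀
      · subst h
        simpa [singleItem, hI, haA (Finset.mem_singleton_self b)] using hb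
      · simp [singleItem, h] at hb
    exact ((hout I hIsize hIcost).approx hsub hmono hnn hzero hc hIT hT hsingle).trans
      (hSAout I hIsize hIcost)
end

section
/- Let g be a nonnegative monotone k-submodular function on 𝒮 with g(∅) = 0, let c_a be a positive integer cost for each a ∈ V, let C ≥ 0 be a real, and let S ∈ 𝒮 be greedy-consistent (there is an ordering (b_1,j_1),…,(b_m,j_m) of the pairs of S such that for each τ, the index j_τ maximizes Δ_{b_τ,i}(S^{τ−1}) over i ∈ [k], where S^{τ−1} consists of the first τ−1 pairs). Let θ ≥ 0 be such that Δ_{a,i}(S) ≤ c_a·θ for all a ∉ U(S) and i ∈ [k]. Then for every T ∈ 𝒮 with Σ_{a ∈ U(T)∖U(S)} c_a ≤ C, one has g(T) ≤ 2·( g(S) + C·θ ). -/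
/-- Marginal gains of a `k`-submodular function decrease along inclusion. -/
theorem KSubmodular.update_add_le {V : Type*} [DecidableEq V] {k : ℕ}
    {g : (V → Option (Fin k)) → ℝ} (hsub : KSubmodular g) {x y : V → Option (Fin k)}
    (hxy : ∀ a i, x a = some i → y a = some i) {a : V} (ha : y a = none) (i : Fin k) :
    g (Function.update y a (some i)) + g x ≤ g (Function.update x a (some i)) + g y := by
  have hxa : x a = none := by
    cases h : x a with
    | none => rfl
    | some j => simp [hxy a j h] at ha
  have hsup : ksup (Function.update x a (some i)) y = Function.update y a (some i) := by
    funext v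
    by_cases hv : v = a
    · subst hv
      simp [ksup, ha]
    · cases h : x v with
      | none => simp [ksup, hv, h]
      | some j => simp [ksup, hv, h, hxy v j h]
  have hinf : kinf (Function.update x a (some i)) y = x := by
    funext v
    by_cases hv : v = a
    · subst hv
      simp [kinf, ha, hxa]
    · cases h : x v with
      | none => simp [kinf, hv, h]
      | some j => simp [kinf, hv, h, hxy v j h]
  simpa only [hsup, hinf] using hsub (Function.update x a (some i)) y

theorem KMonotone.le_update {V : Type*} [DecidableEq V] {k : ℕ}
    {g : (V → Option (Fin k)) → ℝ} (hmono : KMonotone g) {x : V → Option (Fin k)} {a : V}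
    (ha : x a = none) (o : Option (Fin k)) : g x ≤ g (Function.update x a o) := by
  refine hmono _ _ fun v i hv => ?_
  have hva : v ≠ a := by
    rintro rfl
    simp [ha] at hv
  simpa [hva] using hv

/-- Completing `S` by labels of `T` on unselected items gains at most the sum of the bounds on
the marginal gains at `S`. -/
theorem KSubmodular.le_add_sum {V : Type*} [DecidableEq V] {k : ℕ}
    {g : (V → Option (Fin k)) → ℝ} (hsub : KSubmodular g) {S T : V → Option (Fin k)} {w : V → ℝ}
    (hw : ∀ a, S a = none → ∀ i, g (Function.update S a (some i)) - g S ≤ w a) (A : Finset V)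
    (hA : ∀ a ∈ A, T a ≠ none ∧ S a = none) :
    g (fun a => if a ∈ A then T a else S a) ≤ g S + ∑ a ∈ A, w a := by
  induction A using Finset.induction_on with
  | empty => simp
  | insert a A ha ih =>
    have ih := ih fun v hv => hA v (Finset.mem_insert_of_mem hv)
    obtain ⟨hTa, hSa⟩ := hA a (Finset.mem_insert_self a A)
    obtain ⟨i, hi⟩ := Option.ne_none_iff_exists'.mp hTa
    have hins : (fun v => if v ∈ insert a A then T v else S v) =
        Function.update (fun v => if v ∈ A then T v else S v) a (some i) := by
      funext v
      by_cases hv : v = a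
      · subst hv
        simp [hi]
      · simp [hv]
    have hle := hsub.update_add_le (x := S) (y := fun v => if v ∈ A then T v else S v) (a := a)
      (fun v j hv => by
        have hvA : v ∉ A := fun h => by simp [(hA v (Finset.mem_insert_of_mem h)).2] at hv
        simpa [hvA] using hv) (by simpa [ha] using hSa) i
    have hwa := hw a hSa i
    rw [hins, Finset.sum_insert ha]
    linarith

/-- Relabelling or adding one item by a greedy choice for `x` loses at most the gain made on `x`. -/
theorem KSubmodular.or_le_or_update_add {V : Type*} [DecidableEq V] {k : ℕ}
    {g : (V → Option (Fin k)) → ℝ} (hsub : KSubmodular g) (hmono : KMonotone g)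
    {x T : V → Option (Fin k)} {a : V} {j : Fin k} (ha : x a = none)
    (hj : ∀ i, g (Function.update x a (some i)) ≤ g (Function.update x a (some j))) :
    g (fun v => (x v).or (T v)) + g x ≤
      g (fun v => (Function.update x a (some j) v).or (T v)) +
        g (Function.update x a (some j)) := by
  set y : V → Option (Fin k) := Function.update (fun v => (x v).or (T v)) a none with hy
  have hya : y a = none := by simp [hy]
  have hold : (fun v => (x v).or (T v)) = Function.update y a (T a) := by
    funext v
    by_cases hv : v = a
    · subst hv
      simp [ha]
    · simp [hy, hv]
  have hnew : (fun v => (Function.update x a (some j) v).or (T v)) =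
      Function.update y a (some j) := by
    funext v
    by_cases hv : v = a
    · subst hv
      simp
    · simp [hy, hv]
  have hgrow := hmono.le_update hya (some j)
  rw [hold, hnew]
  cases hT : T a with
  | none =>
    rw [← hya, Function.update_eq_self]
    linarith [hmono.le_update ha (some j)]
  | some i =>
    have hxy : ∀ v l, x v = some l → y v = some l := by
      intro v l hv
      have hva : v ≠ a := by
        rintro rfl
        simp [ha] at hv
      simp [hy, hva, hv]
    linarith [hsub.update_add_le hxy hya i, hj i]

/-- **Inequality (4).**  Let `g` be a nonnegative monotone `k`-submodular function with
`g(∅) = 0`, let `c` assign positive integer costs, and let `S` be greedy-consistent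
(its pairs `(b τ, jdx τ)`, `τ < m`, can be ordered so that each index `jdx τ`
maximizes the marginal gain of item `b τ` with respect to the prefix `Sseq τ`).
If `θ ≥ 0` bounds all densities, i.e. `Δ_{a,i}(S) ≤ c_a·θ` for every `a ∉ U(S)` and
`i ∈ [k]`, then every `T` with `Σ_{a ∈ U(T)∖U(S)} c_a ≤ C` satisfies
`g(T) ≤ 2·(g(S) + C·θ)`. -/
theorem greedy_consistent_density_bound
    {V : Type*} [Fintype V] [DecidableEq V] {k : ℕ}
    (g : (V → Option (Fin k)) → ℝ)
    (hsub : KSubmodular g) (hmono : KMonotone g) (hnn : ∀ x, 0 ≤ g x)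
    (hzero : g (fun _ => none) = 0)
    (c : V → ℕ) (hc : ∀ a, 0 < c a)
    (C : ℝ) (hC : 0 ≤ C)
    (m : ℕ) (b : ℕ → V) (jdx : ℕ → Fin k)
    (hinj : ∀ s t, s < m → t < m → b s = b t → s = t)
    (Sseq : ℕ → V → Option (Fin k))
    (hS0 : Sseq 0 = fun _ => none)
    (hstep : ∀ τ < m, Sseq (τ + 1) = Function.update (Sseq τ) (b τ) (some (jdx τ)))
    (hgreedy : ∀ τ < m, ∀ i : Fin k,
      g (Function.update (Sseq τ) (b τ) (some i)) ≤
        g (Function.update (Sseq τ) (b τ) (some (jdx τ))))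
    (S : V → Option (Fin k)) (hS : S = Sseq m)
    (θ : ℝ) (hθ : 0 ≤ θ)
    (hmarg : ∀ a, S a = none → ∀ i : Fin k,
      g (Function.update S a (some i)) - g S ≤ (c a : ℝ) * θ)
    (T : V → Option (Fin k))
    (hTc : (∑ a ∈ Finset.univ.filter (fun a => T a ≠ none ∧ S a = none), (c a : ℝ)) ≤ C) :
    g T ≤ 2 * (g S + C * θ) := by
  have hsupp : ∀ n ≤ m, ∀ a, Sseq n a ≠ none → ∃ s < n, b s = a := by
    intro n
    induction n with
    | zero => simp [hS0]
    | succ n ih =>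
      intro hn a ha
      by_cases hab : a = b n
      · exact ⟨n, n.lt_succ_self, hab.symm⟩
      · rw [hstep n hn, Function.update_of_ne hab] at ha
        obtain ⟨s, hs, hsa⟩ := ih (Nat.le_of_succ_le hn) a ha
        exact ⟨s, hs.trans n.lt_succ_self, hsa⟩
  have hexchange : ∀ n ≤ m, g T ≤ g (fun v => (Sseq n v).or (T v)) + g (Sseq n) := by
    intro n
    induction n with
    | zero => simp [hS0, hzero]
    | succ n ih =>
      intro hn
      have hfresh : Sseq n (b n) = none := by
        by_contra h
        obtain ⟨s, hs, hsb⟩ := hsupp n (Nat.le_of_succ_le hn) _ h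
        exact hs.ne (hinj s n (hs.trans hn) hn hsb)
      have hswap := hsub.or_le_or_update_add hmono (T := T) hfresh (hgreedy n hn)
      rw [← hstep n hn] at hswap
      linarith [ih (Nat.le_of_succ_le hn)]
  have hT := hexchange m le_rfl
  rw [← hS] at hT
  have hfill := hsub.le_add_sum (T := T) hmarg
    (Finset.univ.filter fun a => T a ≠ none ∧ S a = none) (by simp)
  have hunion : (fun a => if a ∈ Finset.univ.filter (fun a => T a ≠ none ∧ S a = none)
      then T a else S a) = fun v => (S v).or (T v) := by
    funext v
    cases hSv : S v <;> cases hTv : T v <;> simp [hSv, hTv]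
  rw [hunion, ← Finset.sum_mul] at hfill
  linarith [mul_le_mul_of_nonneg_right hTc hθ, mul_nonneg hC hθ]
end
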